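/- Assume ε₁ = ε₂ = ε₃ = −1. (a) If (S₁, S₂, S₃) is a hypersymplectic structure on (E, B, b), then the quadruple (T₁, T₂, T₃, G), where T_i := −S_{i−1} ∘ S_{i+1} (indices modulo 3) and G := S₃ ∘ S₂ ∘ S₁, is a hyperkähler structure on (E, B, b), and S_i = G ∘ T_i for i = 1, 2, 3. (b) Conversely, if (T₁, T₂, T₃, G) is a hyperkähler structure on (E, B, b), then (G ∘ T₁, G ∘ T₂, G ∘ T₃) is a hypersymplectic structure on (E, B, b). -/

import Mathlib

variable {E : Type*} [AddCommGroup E] [Module ℝ E]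

/-- The deformed bracket `b_I(X,Y) = b(I X, Y) + b(X, I Y) - I (b(X,Y))`. -/
noncomputable def deform (b : E →ₗ[ℝ] E →ₗ[ℝ] E) (I : E →ₗ[ℝ] E) :
    E →ₗ[ℝ] E →ₗ[ℝ] E :=
  b ∘ₗ I + LinearMap.compl₂ b I - LinearMap.compr₂ b I

/-- The Nijenhuis torsion of `I` with respect to `b`:
`T_b I (X,Y) = b(I X, I Y) - I (b_I(X,Y))`. -/
noncomputable def torsion (b : E →ₗ[ℝ] E →ₗ[ℝ] E) (I : E →ₗ[ℝ] E) (X Y : E) : E :=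
  b (I X) (I Y) - I (deform b I X Y)

/-- The concomitant `C_b(I,J)(X,Y) = b_{I,J}(X,Y) + b_{J,I}(X,Y)`. -/
noncomputable def concomitant (b : E →ₗ[ℝ] E →ₗ[ℝ] E) (I J : E →ₗ[ℝ] E) (X Y : E) : E :=
  deform (deform b I) J X Y + deform (deform b J) I X Y

/-- An ε-hypersymplectic structure on `(E, B, b)`: a triple `S i` (indices in `ZMod 3`,
with `3 ≡ 0`) of `B`-skew-symmetric endomorphisms such that `S i ∘ S i = ε i • id`,
`S i ∘ S j = ε₁ε₂ε₃ • (S j ∘ S i)` for `i ≠ j`, and `b_{S i, S i} = ε i • b`. -/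
noncomputable def IsEpsHypersymplectic (B : E →ₗ[ℝ] E →ₗ[ℝ] ℝ) (b : E →ₗ[ℝ] E →ₗ[ℝ] E)
    (ε : ZMod 3 → ℝ) (S : ZMod 3 → E →ₗ[ℝ] E) : Prop :=
  (∀ i, ∀ X Y : E, B (S i X) Y = - B X (S i Y)) ∧
  (∀ i, S i ∘ₗ S i = ε i • (LinearMap.id : E →ₗ[ℝ] E)) ∧
  (∀ i j, i ≠ j → S i ∘ₗ S j = (ε 0 * ε 1 * ε 2) • (S j ∘ₗ S i)) ∧
  (∀ i, deform (deform b (S i)) (S i) = ε i • b)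

/-- The transition endomorphisms `T i := ε (i-1) • (S (i-1) ∘ S (i+1))`. -/
noncomputable def transMor (ε : ZMod 3 → ℝ) (S : ZMod 3 → E →ₗ[ℝ] E) (i : ZMod 3) :
    E →ₗ[ℝ] E :=
  ε (i - 1) • (S (i - 1) ∘ₗ S (i + 1))

/-- The endomorphism `G := S₃ ∘ S₂ ∘ S₁` (with `S₃ = S 0`). -/
noncomputable def metricG (S : ZMod 3 → E →ₗ[ℝ] E) : E →ₗ[ℝ] E :=
  S 0 ∘ₗ S 2 ∘ₗ S 1


/-- A hyperkähler structure `(T₁, T₂, T₃, G)` on `(E, B, b)`: `G` is a pseudo-metric,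
`T₁, T₂` are anti-commuting `B`-skew-symmetric complex structures, `T₃ = T₁ ∘ T₂`,
`(T₁, G)` and `(T₂, G)` satisfy the hermitian-pair compatibility, and the endomorphisms
`G ∘ Tⱼ` have vanishing Nijenhuis torsion, `j = 1, 2, 3`. -/
noncomputable def IsHyperkahler (B : E →ₗ[ℝ] E →ₗ[ℝ] ℝ) (b : E →ₗ[ℝ] E →ₗ[ℝ] E)
    (T1 T2 T3 G : E →ₗ[ℝ] E) : Prop :=
  (∀ X Y : E, B (G X) Y = B X (G Y)) ∧
  G ∘ₗ G = (LinearMap.id : E →ₗ[ℝ] E) ∧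
  (∀ X Y : E, B (T1 X) Y = - B X (T1 Y)) ∧
  (∀ X Y : E, B (T2 X) Y = - B X (T2 Y)) ∧
  T1 ∘ₗ T1 = -(LinearMap.id : E →ₗ[ℝ] E) ∧
  T2 ∘ₗ T2 = -(LinearMap.id : E →ₗ[ℝ] E) ∧
  (∀ X Y : E, torsion b T1 X Y = 0) ∧
  (∀ X Y : E, torsion b T2 X Y = 0) ∧
  T1 ∘ₗ T2 = -(T2 ∘ₗ T1) ∧
  T3 = T1 ∘ₗ T2 ∧
  (∀ X Y : E, B (G (T1 X)) (T1 Y) = B (G X) Y) ∧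
  (∀ X Y : E, B (G (T2 X)) (T2 Y) = B (G X) Y) ∧
  (∀ X Y : E, torsion b (G ∘ₗ T1) X Y = 0) ∧
  (∀ X Y : E, torsion b (G ∘ₗ T2) X Y = 0) ∧
  (∀ X Y : E, torsion b (G ∘ₗ T3) X Y = 0)

theorem torsion_eq (b : E →ₗ[ℝ] E →ₗ[ℝ] E) (I : E →ₗ[ℝ] E) (X Y : E) :
    torsion b I X Y = b (I X) (I Y) - I (b (I X) Y) - I (b X (I Y)) + I (I (b X Y)) := by
  simp only [torsion, deform, LinearMap.sub_apply, LinearMap.add_apply, LinearMap.comp_apply,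
    LinearMap.compl₂_apply, LinearMap.compr₂_apply, map_sub, map_add]
  abel

theorem apply_apply_of_comp_self {I : E →ₗ[ℝ] E} (hI : I ∘ₗ I = -LinearMap.id) (X : E) :
    I (I X) = -X := by
  simpa using LinearMap.congr_fun hI X

theorem apply_apply_of_anticomm {I J : E →ₗ[ℝ] E} (hIJ : I ∘ₗ J = -(J ∘ₗ I)) (X : E) :
    I (J X) = -J (I X) := by
  simpa using LinearMap.congr_fun hIJ X

/-- For an almost complex structure `S`, the condition `b_{S,S} = -b` says exactly that the
torsion of `S` vanishes. -/
theorem deform_deform_eq_neg_iff (b : E →ₗ[ℝ] E →ₗ[ℝ] E) {S : E →ₗ[ℝ] E}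
    (hS : S ∘ₗ S = -LinearMap.id) :
    deform (deform b S) S = (-1 : ℝ) • b ↔ ∀ X Y, torsion b S X Y = 0 := by
  have hS' := apply_apply_of_comp_self hS
  have key (X Y : E) : deform (deform b S) S X Y = (2 : ℝ) • torsion b S X Y - b X Y := by
    rw [torsion_eq]
    simp only [deform, LinearMap.sub_apply, LinearMap.add_apply, LinearMap.comp_apply,
      LinearMap.compl₂_apply, LinearMap.compr₂_apply, map_sub, map_add, map_neg,
      LinearMap.neg_apply, hS']
    module
  constructor
  · intro h X Y
    have h' := key X Y
    rw [h, LinearMap.smul_apply, LinearMap.smul_apply] at h'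
    linear_combination (norm := module) (-(1 / 2) : ℝ) • h'
  · intro h
    ext X Y
    rw [key, h]
    simp

/-- The composition of two anti-commuting complex structures is torsion-free. -/
theorem torsion_comp_eq_zero (b : E →ₗ[ℝ] E →ₗ[ℝ] E) {I J : E →ₗ[ℝ] E}
    (hI : I ∘ₗ I = -LinearMap.id) (hJ : J ∘ₗ J = -LinearMap.id) (hIJ : I ∘ₗ J = -(J ∘ₗ I))
    (tI : ∀ X Y, torsion b I X Y = 0) (tJ : ∀ X Y, torsion b J X Y = 0) (X Y : E) :
    torsion b (I ∘ₗ J) X Y = 0 := by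
  have hI' := apply_apply_of_comp_self hI
  have hJ' := apply_apply_of_comp_self hJ
  have hIJ' := apply_apply_of_anticomm hIJ
  have h₁ := congrArg J (tI X (J Y))
  have h₂ := congrArg I (tJ (I X) Y)
  have h₃ := congrArg J (tI (J X) Y)
  have h₄ := tI (J X) (J Y)
  have h₅ := tJ X Y
  have h₆ := congrArg I (tJ X (I Y))
  have h₇ := tI X Y
  have h₈ := tJ (I X) (I Y)
  simp only [torsion_eq, LinearMap.comp_apply, map_sub, map_add, map_neg, map_zero,
    LinearMap.neg_apply, hI', hJ', hIJ', neg_neg] at h₁ h₂ h₃ h₄ h₅ h₆ h₇ h₈ ⊢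
  linear_combination (norm := module) (1 / 2 : ℝ) • (h₄ + h₅ + h₇ + h₈ - h₁ - h₂ - h₃ - h₆)

theorem comp_comp_self_of_commute {G T : E →ₗ[ℝ] E} (hG : G ∘ₗ G = LinearMap.id)
    (hGT : ∀ X, T (G X) = G (T X)) (hT : T ∘ₗ T = -LinearMap.id) :
    (G ∘ₗ T) ∘ₗ (G ∘ₗ T) = -LinearMap.id := by
  ext X
  have hG' (X : E) : G (G X) = X := LinearMap.congr_fun hG X
  simp [hGT, hG', apply_apply_of_comp_self hT]

theorem comp_anticomm_of_commute {G T U : E →ₗ[ℝ] E} (hGT : ∀ X, T (G X) = G (T X))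
    (hGU : ∀ X, U (G X) = G (U X)) (hTU : T ∘ₗ U = -(U ∘ₗ T)) :
    (G ∘ₗ T) ∘ₗ (G ∘ₗ U) = -((G ∘ₗ U) ∘ₗ (G ∘ₗ T)) := by
  ext X
  simp [hGT, hGU, apply_apply_of_anticomm hTU]

/-- A skew-symmetric complex structure forming a hermitian pair with `G` commutes with `G`. -/
theorem commute_of_hermitian {B : E →ₗ[ℝ] E →ₗ[ℝ] ℝ}
    (hBnd : ∀ X : E, (∀ Y : E, B X Y = 0) → X = 0) {G T : E →ₗ[ℝ] E}
    (hskew : ∀ X Y, B (T X) Y = -B X (T Y)) (hT : T ∘ₗ T = -LinearMap.id)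
    (hherm : ∀ X Y, B (G (T X)) (T Y) = B (G X) Y) (X : E) : T (G X) = G (T X) := by
  refine sub_eq_zero.1 (hBnd _ fun Y => ?_)
  have h := hherm X (T Y)
  rw [apply_apply_of_comp_self hT, map_neg] at h
  rw [map_sub, LinearMap.sub_apply, hskew]
  linarith

theorem skew_comp_of_commute {B : E →ₗ[ℝ] E →ₗ[ℝ] ℝ} {G T : E →ₗ[ℝ] E}
    (hG : ∀ X Y, B (G X) Y = B X (G Y)) (hT : ∀ X Y, B (T X) Y = -B X (T Y))
    (hGT : ∀ X, T (G X) = G (T X)) (X Y : E) :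
    B ((G ∘ₗ T) X) Y = -B X ((G ∘ₗ T) Y) := by
  simp [hG, hT, hGT]

theorem isHyperkahler_of_isEpsHypersymplectic {B : E →ₗ[ℝ] E →ₗ[ℝ] ℝ}
    {b : E →ₗ[ℝ] E →ₗ[ℝ] E} {S : ZMod 3 → E →ₗ[ℝ] E}
    (h : IsEpsHypersymplectic B b (fun _ => -1) S) :
    IsHyperkahler B b (transMor (fun _ => -1) S 1) (transMor (fun _ => -1) S 2)
      (transMor (fun _ => -1) S 0) (metricG S) ∧
    ∀ i, S i = metricG S ∘ₗ transMor (fun _ => -1) S i := by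
  obtain ⟨hskew, hsq, hanti, hdef⟩ := h
  replace hsq (i) : S i ∘ₗ S i = -LinearMap.id := by simpa using hsq i
  replace hanti (i j) (hij : i ≠ j) : S i ∘ₗ S j = -(S j ∘ₗ S i) := by
    simpa using hanti i j hij
  have htor (i) := (deform_deform_eq_neg_iff b (hsq i)).1 (hdef i)
  have sq (i X) : S i (S i X) = -X := apply_apply_of_comp_self (hsq i) X
  have a02 := apply_apply_of_anticomm (hanti 0 2 (by decide))
  have a10 := apply_apply_of_anticomm (hanti 1 0 (by decide))
  have a12 := apply_apply_of_anticomm (hanti 1 2 (by decide))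
  have hT1 : transMor (fun _ => -1) S 1 = S 2 ∘ₗ S 0 :=
    (neg_one_smul ℝ _).trans (hanti 2 0 (by decide)).symm
  have hT2 : transMor (fun _ => -1) S 2 = S 0 ∘ₗ S 1 :=
    (neg_one_smul ℝ _).trans (hanti 0 1 (by decide)).symm
  have hT0 : transMor (fun _ => -1) S 0 = S 1 ∘ₗ S 2 :=
    (neg_one_smul ℝ _).trans (hanti 1 2 (by decide)).symm
  have hS (i) : S i = metricG S ∘ₗ transMor (fun _ => -1) S i := by
    have e : i = 0 ∨ i = 1 ∨ i = 2 := by revert i; decide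
    rcases e with rfl | rfl | rfl
    · ext X; simp [hT0, metricG, sq, a12]
    · ext X; simp [hT1, metricG, sq, a10, a12]
    · ext X; simp [hT2, metricG, sq, a02, a10]
  refine ⟨⟨?_, ?_, ?_, ?_, ?_, ?_, ?_, ?_, ?_, ?_, ?_, ?_, ?_, ?_, ?_⟩, hS⟩
  · intro X Y; simp [metricG, hskew, a02, a10, a12]
  · ext X; simp [metricG, sq, a02, a10, a12]
  · intro X Y; simp [hT1, hskew, a02]
  · intro X Y; simp [hT2, hskew, a10]
  · ext X; simp [hT1, sq, a02]
  · ext X; simp [hT2, sq, a10]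
  · rw [hT1]
    exact torsion_comp_eq_zero b (hsq 2) (hsq 0) (hanti 2 0 (by decide)) (htor 2) (htor 0)
  · rw [hT2]
    exact torsion_comp_eq_zero b (hsq 0) (hsq 1) (hanti 0 1 (by decide)) (htor 0) (htor 1)
  · ext X; simp [hT1, hT2, sq, a02, a10, a12]
  · ext X; simp [hT0, hT1, hT2, sq, a12]
  · intro X Y; simp [hT1, metricG, hskew, sq, a02, a10, a12]
  · intro X Y; simp [hT2, metricG, hskew, sq, a02, a10, a12]
  · rw [← hS 1]; exact htor 1
  · rw [← hS 2]; exact htor 2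
  · rw [← hS 0]; exact htor 0

theorem isEpsHypersymplectic_of_isHyperkahler {B : E →ₗ[ℝ] E →ₗ[ℝ] ℝ}
    {b : E →ₗ[ℝ] E →ₗ[ℝ] E} (hBnd : ∀ X : E, (∀ Y : E, B X Y = 0) → X = 0)
    {T1 T2 T3 G : E →ₗ[ℝ] E} (h : IsHyperkahler B b T1 T2 T3 G) :
    IsEpsHypersymplectic B b (fun _ => -1)
      (fun i => if i = 1 then G ∘ₗ T1 else if i = 2 then G ∘ₗ T2 else G ∘ₗ T3) := by
  obtain ⟨hG, hG2, s1, s2, q1, q2, -, -, h12, rfl, c1, c2, t1, t2, t3⟩ := h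
  have g1 := commute_of_hermitian hBnd s1 q1 c1
  have g2 := commute_of_hermitian hBnd s2 q2 c2
  have g3 (X) : (T1 ∘ₗ T2) (G X) = G ((T1 ∘ₗ T2) X) := by simp [g1, g2]
  have sq1 := apply_apply_of_comp_self q1
  have sq2 := apply_apply_of_comp_self q2
  have a12 := apply_apply_of_anticomm h12
  have s3 (X Y) : B ((T1 ∘ₗ T2) X) Y = -B X ((T1 ∘ₗ T2) Y) := by simp [s1, s2, a12]
  have q3 : (T1 ∘ₗ T2) ∘ₗ (T1 ∘ₗ T2) = -LinearMap.id := by ext X; simp [sq1, sq2, a12]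
  have h13 : T1 ∘ₗ (T1 ∘ₗ T2) = -((T1 ∘ₗ T2) ∘ₗ T1) := by ext X; simp [sq1, a12]
  have h23 : T2 ∘ₗ (T1 ∘ₗ T2) = -((T1 ∘ₗ T2) ∘ₗ T2) := by ext X; simp [sq2, a12]
  have p1 := comp_comp_self_of_commute hG2 g1 q1
  have p2 := comp_comp_self_of_commute hG2 g2 q2
  have p3 := comp_comp_self_of_commute hG2 g3 q3
  have r12 := comp_anticomm_of_commute g1 g2 h12
  have r13 := comp_anticomm_of_commute g1 g3 h13
  have r23 := comp_anticomm_of_commute g2 g3 h23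
  refine ⟨fun i => ?_, fun i => ?_, fun i j hij => ?_, fun i => ?_⟩
  · dsimp only
    split_ifs
    exacts [skew_comp_of_commute hG s1 g1, skew_comp_of_commute hG s2 g2,
      skew_comp_of_commute hG s3 g3]
  · rw [neg_one_smul]
    dsimp only
    split_ifs
    exacts [p1, p2, p3]
  · have hc : (-1 * -1 * -1 : ℝ) = -1 := by norm_num
    rw [hc, neg_one_smul]
    have e (i : ZMod 3) : i = 0 ∨ i = 1 ∨ i = 2 := by revert i; decide
    rcases e i with rfl | rfl | rfl <;> rcases e j with rfl | rfl | rfl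
    · exact absurd rfl hij
    · exact neg_eq_iff_eq_neg.1 r13.symm
    · exact neg_eq_iff_eq_neg.1 r23.symm
    · exact r13
    · exact absurd rfl hij
    · exact r12
    · exact r23
    · exact neg_eq_iff_eq_neg.1 r12.symm
    · exact absurd rfl hij
  · dsimp only
    split_ifs
    exacts [(deform_deform_eq_neg_iff b p1).2 t1, (deform_deform_eq_neg_iff b p2).2 t2,
      (deform_deform_eq_neg_iff b p3).2 t3]

theorem statement14 (B : E →ₗ[ℝ] E →ₗ[ℝ] ℝ) (b : E →ₗ[ℝ] E →ₗ[ℝ] E)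
    (hBsymm : ∀ X Y : E, B X Y = B Y X)
    (hBnd : ∀ X : E, (∀ Y : E, B X Y = 0) → X = 0) :
    (∀ S : ZMod 3 → E →ₗ[ℝ] E,
      IsEpsHypersymplectic B b (fun _ => -1) S →
        IsHyperkahler B b (transMor (fun _ => -1) S 1) (transMor (fun _ => -1) S 2)
          (transMor (fun _ => -1) S 0) (metricG S) ∧
        ∀ i, S i = metricG S ∘ₗ transMor (fun _ => -1) S i) ∧
    (∀ T1 T2 T3 G : E →ₗ[ℝ] E,
      IsHyperkahler B b T1 T2 T3 G →
        IsEpsHypersymplectic B b (fun _ => -1)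
          (fun i => if i = 1 then G ∘ₗ T1 else if i = 2 then G ∘ₗ T2 else G ∘ₗ T3)) := by
  exact ⟨fun _ => isHyperkahler_of_isEpsHypersymplectic,
    fun _ _ _ _ => isEpsHypersymplectic_of_isHyperkahler hBnd⟩
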